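/- For every integer g ≥ 1, every τ ∈ ℍ_g, every z ∈ ℂ^g and all ε, δ ∈ {0,1}^g: θ_{[ε,δ]}(τ, z/2)⁴ = 2^{−g}·Σ_{α,β ∈ {0,1}^g} (−1)^{α·δ + β·ε}·θ_{[α,β]}(τ)³·θ_{[α,β]}(τ, z), where α·δ := Σ_{j=1}^g α_j δ_j. -/

import Mathlib

open scoped BigOperators

noncomputable section

/-- The Siegel upper half-space: symmetric complex matrices with positive
definite imaginary part (indexed by a finite type `ι`). -/
def Siegel (ι : Type) [Fintype ι] : Set (Matrix ι ι ℂ) :=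
  {τ | τ.IsSymm ∧ ∀ v : ι → ℝ, v ≠ 0 → 0 < ∑ i, ∑ j, v i * (τ i j).im * v j}

/-- The theta function with characteristic `[ε, δ]`. -/
def theta {ι : Type} [Fintype ι] (ε δ : ι → ZMod 2) (τ : Matrix ι ι ℂ) (z : ι → ℂ) : ℂ :=
  ∑' n : ι → ℤ, Complex.exp ((Real.pi : ℂ) * Complex.I *
    ((∑ i, ∑ j, ((n i : ℂ) + ((ε i).val : ℂ) / 2) * τ i j * ((n j : ℂ) + ((ε j).val : ℂ) / 2)) +
     2 * ∑ i, ((n i : ℂ) + ((ε i).val : ℂ) / 2) * (z i + ((δ i).val : ℂ) / 2)))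

/-- A theta characteristic, an element of `𝔽₂^{2g}`. -/
abbrev Char2 (ι : Type) := (ι → ZMod 2) × (ι → ZMod 2)

/-- Theta function, with the characteristic as a pair. -/
def thetaChar {ι : Type} [Fintype ι] (m : Char2 ι) (τ : Matrix ι ι ℂ) (z : ι → ℂ) : ℂ :=
  theta m.1 m.2 τ z

/-- Theta constant. -/
def thetaConst {ι : Type} [Fintype ι] (m : Char2 ι) (τ : Matrix ι ι ℂ) : ℂ :=
  thetaChar m τ 0

/-- The summand of the series defining `theta`. -/
def thetaTerm {ι : Type} [Fintype ι] (ε δ : ι → ZMod 2) (τ : Matrix ι ι ℂ) (z : ι → ℂ)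
    (n : ι → ℤ) : ℂ :=
  Complex.exp ((Real.pi : ℂ) * Complex.I *
    ((∑ i, ∑ j, ((n i : ℂ) + ((ε i).val : ℂ) / 2) * τ i j * ((n j : ℂ) + ((ε j).val : ℂ) / 2)) +
     2 * ∑ i, ((n i : ℂ) + ((ε i).val : ℂ) / 2) * (z i + ((δ i).val : ℂ) / 2)))

lemma theta_eq_tsum {ι : Type} [Fintype ι] (ε δ : ι → ZMod 2) (τ : Matrix ι ι ℂ) (z : ι → ℂ) :
    theta ε δ τ z = ∑' n, thetaTerm ε δ τ z n := rfl

/-! ### Absolute convergence of the theta series -/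

lemma Siegel.exists_pos_mul_sum_sq_le {ι : Type} [Fintype ι] {τ : Matrix ι ι ℂ}
    (hτ : τ ∈ Siegel ι) :
    ∃ c : ℝ, 0 < c ∧ ∀ v : ι → ℝ, c * ∑ i, v i ^ 2 ≤ ∑ i, ∑ j, v i * (τ i j).im * v j := by
  set F : (ι → ℝ) → ℝ := fun v => ∑ i, ∑ j, v i * (τ i j).im * v j with hF
  set K : Set (ι → ℝ) := {v | ∑ i, v i ^ 2 = 1} with hK
  have hFc : Continuous F := by fun_prop
  have hKc : IsCompact K := by
    refine Metric.isCompact_of_isClosed_isBounded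
      (isClosed_eq (by fun_prop) continuous_const) ?_
    refine (Metric.isBounded_closedBall (x := (0 : ι → ℝ)) (r := 1)).subset fun v hv => ?_
    rw [mem_closedBall_zero_iff, pi_norm_le_iff_of_nonneg zero_le_one]
    intro i
    have h1 : v i ^ 2 ≤ 1 := by
      have h : ∑ i, v i ^ 2 = 1 := hv
      rw [← h]
      exact Finset.single_le_sum (f := fun i => v i ^ 2) (fun _ _ => sq_nonneg _)
        (Finset.mem_univ i)
    rw [Real.norm_eq_abs]
    exact (sq_le_one_iff_abs_le_one _).mp h1
  obtain ⟨c, hc, hcK⟩ : ∃ c : ℝ, 0 < c ∧ ∀ v ∈ K, c ≤ F v := by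
    rcases K.eq_empty_or_nonempty with h | h
    · exact ⟨1, one_pos, by simp [h]⟩
    · obtain ⟨v, hv, hmin⟩ := hKc.exists_isMinOn h hFc.continuousOn
      refine ⟨F v, hτ.2 v ?_, fun w hw => hmin hw⟩
      rintro rfl
      simp [hK] at hv
  refine ⟨c, hc, fun v => ?_⟩
  have hs0 : 0 ≤ ∑ i, v i ^ 2 := Finset.sum_nonneg fun _ _ => sq_nonneg _
  rcases hs0.eq_or_lt with h0 | hpos
  · have hv : v = 0 := by
      funext i
      have := (Finset.sum_eq_zero_iff_of_nonneg (fun i _ => sq_nonneg (v i))).mp h0.symm i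
        (Finset.mem_univ i)
      simpa using this
    simp [hv]
  · set s := ∑ i, v i ^ 2 with hs
    set r := Real.sqrt s
    have hr : r ^ 2 = s := Real.sq_sqrt hs0
    have hrp : 0 < r := Real.sqrt_pos.mpr hpos
    have hmem : (fun i => v i / r) ∈ K := by
      simp only [hK, Set.mem_ofPred_eq, div_pow, ← Finset.sum_div, hr]
      exact div_self hpos.ne'
    have hle := hcK _ hmem
    have hscale : F (fun i => v i / r) * s = F v := by
      simp only [hF, Finset.sum_mul, ← hr]
      refine Finset.sum_congr rfl fun i _ => Finset.sum_congr rfl fun j _ => ?_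
      field_simp
    calc c * s ≤ F (fun i => v i / r) * s := by gcongr
      _ = F v := hscale

lemma summable_prod_fin {β : Type*} : ∀ {g : ℕ} {h : Fin g → β → ℝ}, (∀ i b, 0 ≤ h i b) →
    (∀ i, Summable (h i)) → Summable fun n : Fin g → β => ∏ i, h i (n i)
  | 0, _, _, _ => Summable.of_finite
  | g + 1, h, h0, hs => by
    rw [← (Fin.consEquiv fun _ : Fin (g + 1) => β).summable_iff]
    have ih := summable_prod_fin (h := fun i => h i.succ) (fun i => h0 _) (fun i => hs _)
    have := (hs 0).mul_of_nonneg ih (fun b => h0 0 b)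
      (fun n => Finset.prod_nonneg fun i _ => h0 _ _)
    refine this.congr fun p => ?_
    simp [Fin.prod_univ_succ, Fin.consEquiv]

lemma summable_exp_gaussian_shift {c : ℝ} (hc : 0 < c) (e y : ℝ) :
    Summable fun n : ℤ => Real.exp (-Real.pi * (c * (n + e) ^ 2 + 2 * ((n + e) * y))) := by
  have h := ((summable_jacobiTheta₂_term_iff (Complex.I * ((y + c * e : ℝ) : ℂ))
    (Complex.I * (c : ℂ))).mpr (by simpa using hc)).norm
  refine (h.mul_left (Real.exp (-Real.pi * (c * e ^ 2 + 2 * (e * y))))).congr fun n => ?_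
  rw [norm_jacobiTheta₂_term, ← Real.exp_add, Complex.I_mul_im, Complex.I_mul_im,
    Complex.ofReal_re, Complex.ofReal_re]
  congr 1
  ring

lemma norm_thetaTerm {ι : Type} [Fintype ι] (ε δ : ι → ZMod 2) (τ : Matrix ι ι ℂ)
    (z : ι → ℂ) (n : ι → ℤ) :
    ‖thetaTerm ε δ τ z n‖ = Real.exp (-Real.pi *
      ((∑ i, ∑ j, ((n i : ℝ) + ((ε i).val : ℝ) / 2) * (τ i j).im *
        ((n j : ℝ) + ((ε j).val : ℝ) / 2)) +
        2 * ∑ i, ((n i : ℝ) + ((ε i).val : ℝ) / 2) * (z i).im)) := by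
  have hx (i) : (n i : ℂ) + ((ε i).val : ℂ) / 2 = (((n i : ℝ) + ((ε i).val : ℝ) / 2 : ℝ) : ℂ) := by
    push_cast; rfl
  have hd (i) : ((δ i).val : ℂ) / 2 = ((((δ i).val : ℝ) / 2 : ℝ) : ℂ) := by
    push_cast; rfl
  have h2 (w : ℂ) : (2 * w).im = 2 * w.im := by simp
  have hI (w : ℂ) : ((Real.pi : ℂ) * Complex.I * w).re = -Real.pi * w.im := by simp
  simp only [thetaTerm, Complex.norm_exp, hx, hd, hI, Complex.add_im, h2, Complex.im_sum,
    Complex.im_mul_ofReal, Complex.im_ofReal_mul, Complex.ofReal_im,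
    add_zero]

lemma summable_norm_thetaTerm {g : ℕ} {τ : Matrix (Fin g) (Fin g) ℂ} (hτ : τ ∈ Siegel (Fin g))
    (ε δ : Fin g → ZMod 2) (z : Fin g → ℂ) :
    Summable fun n => ‖thetaTerm ε δ τ z n‖ := by
  obtain ⟨c, hc, hcF⟩ := Siegel.exists_pos_mul_sum_sq_le hτ
  refine Summable.of_nonneg_of_le (fun _ => norm_nonneg _) (fun n => ?_)
    (summable_prod_fin (fun _ _ => (Real.exp_pos _).le)
      fun i => summable_exp_gaussian_shift hc (((ε i).val : ℝ) / 2) (z i).im)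
  rw [norm_thetaTerm, ← Real.exp_sum, Real.exp_le_exp, ← Finset.mul_sum, Finset.sum_add_distrib,
    ← Finset.mul_sum, ← Finset.mul_sum]
  have := hcF fun i => (n i : ℝ) + ((ε i).val : ℝ) / 2
  have hpi := Real.pi_pos
  simp only [neg_mul, neg_le_neg_iff]
  gcongr

/-! ### Products of four series -/

lemma summable_norm_mul_four {L : Type*} {a b c d : L → ℂ} (ha : Summable fun n => ‖a n‖)
    (hb : Summable fun n => ‖b n‖) (hc : Summable fun n => ‖c n‖) (hd : Summable fun n => ‖d n‖) :
    Summable fun p : (L × L) × L × L => ‖a p.1.1 * b p.1.2 * (c p.2.1 * d p.2.2)‖ :=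
  Summable.mul_norm (f := fun x : L × L => a x.1 * b x.2) (g := fun x : L × L => c x.1 * d x.2)
    (ha.mul_norm hb) (hc.mul_norm hd)

lemma tsum_mul_four {L : Type*} {a b c d : L → ℂ} (ha : Summable fun n => ‖a n‖)
    (hb : Summable fun n => ‖b n‖) (hc : Summable fun n => ‖c n‖) (hd : Summable fun n => ‖d n‖) :
    (∑' n, a n) * (∑' n, b n) * ((∑' n, c n) * ∑' n, d n) =
      ∑' p : (L × L) × L × L, a p.1.1 * b p.1.2 * (c p.2.1 * d p.2.2) := by
  rw [tsum_mul_tsum_of_summable_norm ha hb, tsum_mul_tsum_of_summable_norm hc hd]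
  exact tsum_mul_tsum_of_summable_norm (f := fun x : L × L => a x.1 * b x.2)
    (g := fun x : L × L => c x.1 * d x.2) (ha.mul_norm hb) (hc.mul_norm hd)

/-! ### Character sums over `𝔽₂^g` -/

lemma exp_pi_mul_I_mul_intCast (k : ℤ) :
    Complex.exp ((Real.pi : ℂ) * Complex.I * k) = (-1) ^ k := by
  rw [mul_comm, Complex.exp_int_mul, Complex.exp_pi_mul_I]

lemma sum_exp_pi_mul_I_val_mul {ι : Type} [Fintype ι] [DecidableEq ι] (N : ι → ℤ) :
    ∑ β : ι → ZMod 2, Complex.exp ((Real.pi : ℂ) * Complex.I * ∑ j, ((β j).val : ℂ) * (N j : ℂ)) =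
      if ∀ j, Even (N j) then (2 : ℂ) ^ Fintype.card ι else 0 := by
  have h1 (j : ι) : ∑ b : ZMod 2, Complex.exp ((Real.pi : ℂ) * Complex.I * ((b.val : ℂ) * N j)) =
      if Even (N j) then 2 else 0 := by
    have h : ∑ b : ZMod 2, Complex.exp ((Real.pi : ℂ) * Complex.I * ((b.val : ℂ) * N j)) =
        Complex.exp ((Real.pi : ℂ) * Complex.I * ((0 : ℕ) * N j)) +
        Complex.exp ((Real.pi : ℂ) * Complex.I * ((1 : ℕ) * N j)) := Fin.sum_univ_two _
    rw [h]
    simp only [Nat.cast_zero, Nat.cast_one, zero_mul, mul_zero, one_mul, Complex.exp_zero,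
      exp_pi_mul_I_mul_intCast]
    split_ifs with he
    · rw [he.neg_one_zpow]; norm_num
    · rw [(Int.not_even_iff_odd.mp he).neg_one_zpow]; norm_num
  simp_rw [Finset.mul_sum, Complex.exp_sum]
  rw [← Fintype.piFinset_univ, ← Finset.prod_univ_sum (fun _ : ι => (Finset.univ : Finset (ZMod 2)))
    fun j b => Complex.exp ((Real.pi : ℂ) * Complex.I * ((b.val : ℂ) * N j))]
  simp_rw [h1]
  split_ifs with he
  · simp [he]
  · push Not at he
    obtain ⟨j, hj⟩ := he
    exact Finset.prod_eq_zero (Finset.mem_univ j) (by simp [hj])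

/-! ### The orthogonal change of lattice variables -/

/-- Four lattice vectors. -/
abbrev Quad (g : ℕ) :=
  ((Fin g → ℤ) × (Fin g → ℤ)) × (Fin g → ℤ) × (Fin g → ℤ)

/-- The change of variables of Riemann's relations: if `y_k = m_k + ε / 2`, the image
`(α, n)` satisfies `n₄ + α / 2 = (y₁ + y₂ + y₃ + y₄) / 2` and, for instance,
`n₁ + α / 2 = (y₄ + y₁ - y₂ - y₃) / 2`. -/
def riemannMap {g : ℕ} (ε : Fin g → ZMod 2) (m : Quad g) : (Fin g → ZMod 2) × Quad g :=
  let r (j : Fin g) : ℤ := (m.1.1 j + m.1.2 j + m.2.1 j + m.2.2 j) % 2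
  (fun j => ((m.1.1 j + m.1.2 j + m.2.1 j + m.2.2 j : ℤ) : ZMod 2),
    ((fun j => (m.2.2 j + m.1.1 j - m.1.2 j - m.2.1 j - r j) / 2,
      fun j => (m.2.2 j + m.1.2 j - m.1.1 j - m.2.1 j - r j) / 2),
     (fun j => (m.2.2 j + m.2.1 j - m.1.1 j - m.1.2 j - r j) / 2,
      fun j => (m.1.1 j + m.1.2 j + m.2.1 j + m.2.2 j - r j) / 2 + (ε j).val)))

section riemannMap

variable {g : ℕ} (ε : Fin g → ZMod 2)

lemma riemannMap_val (m : Quad g) (j : Fin g) :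
    (((riemannMap ε m).1 j).val : ℤ) = (m.1.1 j + m.1.2 j + m.2.1 j + m.2.2 j) % 2 := by
  simp only [riemannMap, ZMod.val_intCast, Nat.cast_ofNat]

/-- The defining equations of `riemannMap`, cleared of denominators. -/
lemma riemannMap_spec (m : Quad g) (j : Fin g) :
    2 * (riemannMap ε m).2.1.1 j + ((riemannMap ε m).1 j).val =
        m.2.2 j + m.1.1 j - m.1.2 j - m.2.1 j ∧
      2 * (riemannMap ε m).2.1.2 j + ((riemannMap ε m).1 j).val =
        m.2.2 j + m.1.2 j - m.1.1 j - m.2.1 j ∧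
      2 * (riemannMap ε m).2.2.1 j + ((riemannMap ε m).1 j).val =
        m.2.2 j + m.2.1 j - m.1.1 j - m.1.2 j ∧
      2 * (riemannMap ε m).2.2.2 j + ((riemannMap ε m).1 j).val =
        m.1.1 j + m.1.2 j + m.2.1 j + m.2.2 j + 2 * (ε j).val := by
  rw [riemannMap_val]
  simp only [riemannMap]
  omega

lemma riemannMap_injective : Function.Injective (riemannMap ε) := by
  intro m m' h
  have key (j : Fin g) : m.1.1 j = m'.1.1 j ∧ m.1.2 j = m'.1.2 j ∧ m.2.1 j = m'.2.1 j ∧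
      m.2.2 j = m'.2.2 j := by
    have h1 := riemannMap_spec ε m j
    have h2 := riemannMap_spec ε m' j
    rw [h] at h1
    omega
  refine Prod.ext (Prod.ext ?_ ?_) (Prod.ext ?_ ?_) <;> funext j
  exacts [(key j).1, (key j).2.1, (key j).2.2.1, (key j).2.2.2]

/-- The parity condition cutting out the range of `riemannMap`. -/
lemma mem_range_riemannMap_iff (q : (Fin g → ZMod 2) × Quad g) :
    q ∈ Set.range (riemannMap ε) ↔
      ∀ j, Even ((ε j).val + (q.2.1.1 j + q.2.1.2 j + q.2.2.1 j + q.2.2.2 j)) := by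
  constructor
  · rintro ⟨m, rfl⟩ j
    have h := riemannMap_spec ε m j
    rw [Int.even_iff]
    omega
  · intro hq
    obtain ⟨α, ⟨n₁, n₂⟩, n₃, n₄⟩ := q
    simp only [Int.even_iff] at hq
    set m : Quad g := ((fun j => (n₄ j + n₁ j - n₂ j - n₃ j - (ε j).val) / 2,
      fun j => (n₄ j + n₂ j - n₁ j - n₃ j - (ε j).val) / 2),
      (fun j => (n₄ j + n₃ j - n₁ j - n₂ j - (ε j).val) / 2,
      fun j => (n₁ j + n₂ j + n₃ j + n₄ j + 2 * (α j).val - (ε j).val) / 2))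
    refine ⟨m, ?_⟩
    have key (j : Fin g) : ((riemannMap ε m).1 j).val = (α j).val ∧
        (riemannMap ε m).2.1.1 j = n₁ j ∧ (riemannMap ε m).2.1.2 j = n₂ j ∧
        (riemannMap ε m).2.2.1 j = n₃ j ∧ (riemannMap ε m).2.2.2 j = n₄ j := by
      have h1 := riemannMap_spec ε m j
      have h2 := riemannMap_val ε m j
      have h3 := hq j
      have h4 := ZMod.val_lt (α j)
      generalize riemannMap ε m = q at h1 h2 ⊢
      simp only [m] at h1 h2 h3
      omega
    refine Prod.ext ?_ (Prod.ext (Prod.ext ?_ ?_) (Prod.ext ?_ ?_)) <;> funext j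
    exacts [ZMod.val_injective 2 (key j).1, (key j).2.1, (key j).2.2.1, (key j).2.2.2.1,
      (key j).2.2.2.2]

end riemannMap

/-- The summand of the right-hand side of Riemann's relation once the sum over the second
characteristic has been carried out, without the parity condition. -/
def riemannTerm {g : ℕ} (δ : Fin g → ZMod 2) (τ : Matrix (Fin g) (Fin g) ℂ) (z : Fin g → ℂ)
    (q : (Fin g → ZMod 2) × Quad g) : ℂ :=
  Complex.exp ((Real.pi : ℂ) * Complex.I * ∑ j, ((q.1 j).val : ℂ) * ((δ j).val : ℂ)) *
    (thetaTerm q.1 0 τ 0 q.2.1.1 * thetaTerm q.1 0 τ 0 q.2.1.2 *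
      (thetaTerm q.1 0 τ 0 q.2.2.1 * thetaTerm q.1 0 τ z q.2.2.2))

lemma thetaTerm_eq_mul {ι : Type} [Fintype ι] (α β : ι → ZMod 2) (τ : Matrix ι ι ℂ) (z : ι → ℂ)
    (n : ι → ℤ) :
    thetaTerm α β τ z n = thetaTerm α 0 τ z n * Complex.exp ((Real.pi : ℂ) * Complex.I *
      ∑ j, ((n j : ℂ) + ((α j).val : ℂ) / 2) * ((β j).val : ℂ)) := by
  rw [thetaTerm, thetaTerm, ← Complex.exp_add, ← mul_add]
  congr 2
  rw [add_assoc, add_right_inj, Finset.mul_sum, Finset.mul_sum, ← Finset.sum_add_distrib]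
  refine Finset.sum_congr rfl fun i _ => ?_
  simp only [Pi.zero_apply, ZMod.val_zero, Nat.cast_zero]
  ring

lemma neg_one_pow_mul_thetaTerm_mul {g : ℕ} (ε δ : Fin g → ZMod 2)
    (τ : Matrix (Fin g) (Fin g) ℂ) (z : Fin g → ℂ) (α β : Fin g → ZMod 2) (p : Quad g) :
    (-1 : ℂ) ^ (∑ j, (α j).val * (δ j).val + ∑ j, (β j).val * (ε j).val) *
      (thetaTerm α β τ 0 p.1.1 * thetaTerm α β τ 0 p.1.2 *
        (thetaTerm α β τ 0 p.2.1 * thetaTerm α β τ z p.2.2)) =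
    riemannTerm δ τ z (α, p) * Complex.exp ((Real.pi : ℂ) * Complex.I * ∑ j, ((β j).val : ℂ) *
      (((ε j).val + (p.1.1 j + p.1.2 j + p.2.1 j + p.2.2 j) : ℤ) : ℂ)) := by
  have hsign : (-1 : ℂ) ^ (∑ j, (α j).val * (δ j).val + ∑ j, (β j).val * (ε j).val) =
      Complex.exp ((Real.pi : ℂ) * Complex.I * ∑ j, ((α j).val : ℂ) * ((δ j).val : ℂ)) *
      Complex.exp ((Real.pi : ℂ) * Complex.I * ∑ j, ((β j).val : ℂ) * ((ε j).val : ℂ)) := by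
    rw [← zpow_natCast, ← exp_pi_mul_I_mul_intCast, ← Complex.exp_add, ← mul_add]
    push_cast
    rfl
  rw [hsign, riemannTerm]
  simp only [thetaTerm_eq_mul α β]
  have hexp : Complex.exp ((Real.pi : ℂ) * Complex.I * ∑ j, ((β j).val : ℂ) *
      (((ε j).val + (p.1.1 j + p.1.2 j + p.2.1 j + p.2.2 j) : ℤ) : ℂ)) =
      Complex.exp ((Real.pi : ℂ) * Complex.I * ∑ j, ((β j).val : ℂ) * ((ε j).val : ℂ)) *
      (Complex.exp ((Real.pi : ℂ) * Complex.I *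
        ∑ j, ((p.1.1 j : ℂ) + ((α j).val : ℂ) / 2) * ((β j).val : ℂ)) *
      Complex.exp ((Real.pi : ℂ) * Complex.I *
        ∑ j, ((p.1.2 j : ℂ) + ((α j).val : ℂ) / 2) * ((β j).val : ℂ)) *
      Complex.exp ((Real.pi : ℂ) * Complex.I *
        ∑ j, ((p.2.1 j : ℂ) + ((α j).val : ℂ) / 2) * ((β j).val : ℂ)) *
      Complex.exp ((Real.pi : ℂ) * Complex.I *
        ∑ j, ((p.2.2 j : ℂ) + ((α j).val : ℂ) / 2) * ((β j).val : ℂ))) := by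
    simp only [← Complex.exp_add, ← mul_add, ← Finset.sum_add_distrib]
    rw [Complex.exp_eq_exp_iff_exists_int]
    refine ⟨-∑ j, ((α j).val : ℤ) * (β j).val, ?_⟩
    have : ∑ j, ((β j).val : ℂ) *
        (((ε j).val + (p.1.1 j + p.1.2 j + p.2.1 j + p.2.2 j) : ℤ) : ℂ) =
        ∑ j, (((β j).val : ℂ) * ((ε j).val : ℂ) +
          (((p.1.1 j : ℂ) + ((α j).val : ℂ) / 2) * ((β j).val : ℂ) +
          ((p.1.2 j : ℂ) + ((α j).val : ℂ) / 2) * ((β j).val : ℂ) +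
          ((p.2.1 j : ℂ) + ((α j).val : ℂ) / 2) * ((β j).val : ℂ) +
          ((p.2.2 j : ℂ) + ((α j).val : ℂ) / 2) * ((β j).val : ℂ))) -
        2 * ∑ j, ((α j).val : ℂ) * ((β j).val : ℂ) := by
      rw [Finset.mul_sum, ← Finset.sum_sub_distrib]
      refine Finset.sum_congr rfl fun j _ => ?_
      push_cast
      ring
    rw [this]
    push_cast
    ring
  rw [hexp]
  ring

lemma riemannTerm_riemannMap {g : ℕ} (ε δ : Fin g → ZMod 2)
    (τ : Matrix (Fin g) (Fin g) ℂ) (z : Fin g → ℂ) (m : Quad g) :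
    riemannTerm δ τ z (riemannMap ε m) =
      thetaTerm ε δ τ (fun i => z i / 2) m.1.1 * thetaTerm ε δ τ (fun i => z i / 2) m.1.2 *
      (thetaTerm ε δ τ (fun i => z i / 2) m.2.1 * thetaTerm ε δ τ (fun i => z i / 2) m.2.2) := by
  have hspec := riemannMap_spec ε m
  generalize riemannMap ε m = q at hspec ⊢
  obtain ⟨⟨m₁, m₂⟩, m₃, m₄⟩ := m
  obtain ⟨α, ⟨n₁, n₂⟩, n₃, n₄⟩ := q
  simp only at hspec
  have h₁ (j) : (n₁ j : ℂ) + ((α j).val : ℂ) / 2 = (m₄ j + m₁ j - m₂ j - m₃ j) / 2 := by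
    have := congrArg (Int.cast : ℤ → ℂ) (hspec j).1
    push_cast at this
    linear_combination this / 2
  have h₂ (j) : (n₂ j : ℂ) + ((α j).val : ℂ) / 2 = (m₄ j + m₂ j - m₁ j - m₃ j) / 2 := by
    have := congrArg (Int.cast : ℤ → ℂ) (hspec j).2.1
    push_cast at this
    linear_combination this / 2
  have h₃ (j) : (n₃ j : ℂ) + ((α j).val : ℂ) / 2 = (m₄ j + m₃ j - m₁ j - m₂ j) / 2 := by
    have := congrArg (Int.cast : ℤ → ℂ) (hspec j).2.2.1
    push_cast at this
    linear_combination this / 2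
  have h₄ (j) : (n₄ j : ℂ) + ((α j).val : ℂ) / 2 =
      (m₁ j + m₂ j + m₃ j + m₄ j) / 2 + (ε j).val := by
    have := congrArg (Int.cast : ℤ → ℂ) (hspec j).2.2.2
    push_cast at this
    linear_combination this / 2
  simp only [riemannTerm, thetaTerm, h₁, h₂, h₃, h₄, ← Complex.exp_add, ← mul_add]
  rw [Complex.exp_eq_exp_iff_exists_int]
  refine ⟨-∑ j, n₄ j * (δ j).val, ?_⟩
  have hα (j) : ((α j).val : ℂ) = m₁ j + m₂ j + m₃ j + m₄ j + 2 * (ε j).val - 2 * n₄ j := by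
    linear_combination 2 * h₄ j
  push_cast
  rw [show ((-∑ j, (n₄ j : ℂ) * ((δ j).val : ℂ)) * (2 * (Real.pi : ℂ) * Complex.I)) =
    (Real.pi : ℂ) * Complex.I * (-2 * ∑ j, (n₄ j : ℂ) * ((δ j).val : ℂ)) by ring, ← mul_add]
  congr 1
  have hquad : ∀ A B C D A' B' C' D' U U₁ U₂ U₃ U₄ V V₁ V₂ V₃ V₄ : ℂ,
      A + B + C + D = A' + B' + C' + D' →
      U + U₁ + U₂ + U₃ + U₄ = V + V₁ + V₂ + V₃ + V₄ →
      U + ((A + U₁) + (B + U₂) + ((C + U₃) + (D + U₄))) =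
      (A' + V₁) + (B' + V₂) + ((C' + V₃) + (D' + V₄)) + V := by
    intro _ _ _ _ _ _ _ _ _ _ _ _ _ _ _ _ _ _ hA hU
    linear_combination hA + hU
  apply hquad
  · simp only [← Finset.sum_add_distrib]
    refine Finset.sum_congr rfl fun i _ => Finset.sum_congr rfl fun j _ => ?_
    ring
  · simp only [Finset.mul_sum, ← Finset.sum_add_distrib]
    refine Finset.sum_congr rfl fun i _ => ?_
    simp only [Pi.zero_apply, ZMod.val_zero, Nat.cast_zero, hα]
    ring

/-- A special case of Riemann's relations: the fourth power of a theta function at `z/2`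
as a sum of products of theta constants and theta functions. -/
theorem theta_fourth_power_half (g : ℕ) (hg : 1 ≤ g)
    (τ : Matrix (Fin g) (Fin g) ℂ) (hτ : τ ∈ Siegel (Fin g))
    (z : Fin g → ℂ) (ε δ : Fin g → ZMod 2) :
    theta ε δ τ (fun i => z i / 2) ^ 4 =
    (2 : ℂ)⁻¹ ^ g * ∑ α : Fin g → ZMod 2, ∑ β : Fin g → ZMod 2,
      (-1 : ℂ) ^ (∑ j, (α j).val * (δ j).val + ∑ j, (β j).val * (ε j).val) *
        theta α β τ 0 ^ 3 * theta α β τ z := by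
  classical
  have hs (α β : Fin g → ZMod 2) (w : Fin g → ℂ) := summable_norm_thetaTerm hτ α β w
  have hrow (α : Fin g → ZMod 2) : Summable fun p : Quad g => ‖riemannTerm δ τ z (α, p)‖ := by
    simp only [riemannTerm, norm_mul _ (_ * _ * _)]
    exact (summable_norm_mul_four (hs α 0 0) (hs α 0 0) (hs α 0 0) (hs α 0 z)).mul_left _
  have hall : Summable (riemannTerm δ τ z) :=
    .of_norm ((summable_prod_of_nonneg fun _ => norm_nonneg _).mpr ⟨hrow, .of_finite⟩)
  set R := Set.range (riemannMap ε)
  have hα (α : Fin g → ZMod 2) : ∑ β : Fin g → ZMod 2,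
      (-1 : ℂ) ^ (∑ j, (α j).val * (δ j).val + ∑ j, (β j).val * (ε j).val) *
        theta α β τ 0 ^ 3 * theta α β τ z =
      2 ^ g * ∑' p : Quad g, R.indicator (riemannTerm δ τ z) (α, p) := by
    have hβ (β : Fin g → ZMod 2) :
        (-1 : ℂ) ^ (∑ j, (α j).val * (δ j).val + ∑ j, (β j).val * (ε j).val) *
          theta α β τ 0 ^ 3 * theta α β τ z = ∑' p : Quad g,
        (-1 : ℂ) ^ (∑ j, (α j).val * (δ j).val + ∑ j, (β j).val * (ε j).val) *
          (thetaTerm α β τ 0 p.1.1 * thetaTerm α β τ 0 p.1.2 *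
            (thetaTerm α β τ 0 p.2.1 * thetaTerm α β τ z p.2.2)) := by
      rw [tsum_mul_left, ← tsum_mul_four (hs α β 0) (hs α β 0) (hs α β 0) (hs α β z),
        ← theta_eq_tsum, ← theta_eq_tsum]
      ring
    rw [Finset.sum_congr rfl fun β _ => hβ β, ← Summable.tsum_finsetSum fun β _ =>
      ((summable_norm_mul_four (hs α β 0) (hs α β 0) (hs α β 0) (hs α β z)).of_norm).mul_left _,
      ← tsum_mul_left]
    refine tsum_congr fun p => ?_
    simp only [neg_one_pow_mul_thetaTerm_mul, ← Finset.mul_sum]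
    rw [sum_exp_pi_mul_I_val_mul fun j => (ε j).val + (p.1.1 j + p.1.2 j + p.2.1 j + p.2.2 j)]
    simp only [Fintype.card_fin, Set.indicator_apply, R, mem_range_riemannMap_iff]
    split_ifs <;> ring
  have hprod := (hall.indicator R).tsum_prod.trans (tsum_fintype _)
  rw [Finset.sum_congr rfl fun α _ => hα α, ← Finset.mul_sum, ← mul_assoc, ← mul_pow,
    inv_mul_cancel₀ two_ne_zero, one_pow, one_mul, ← hprod,
    ← (riemannMap_injective ε).tsum_eq Set.support_indicator_subset]
  simp only [Set.indicator_of_mem (Set.mem_range_self _), riemannTerm_riemannMap]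
  rw [← tsum_mul_four (hs ε δ _) (hs ε δ _) (hs ε δ _) (hs ε δ _)]
  simp only [← theta_eq_tsum]
  ring
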